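/- arXiv:2112.03832 — 2 statements merged into one kernel-verified Lean document; each statement's English description precedes it below -/
import Mathlib

section
/- Let n ≥ 1, w ∈ L^1_loc(ℝ^n) and δ > 0, and let w^δ be the piecewise constant δ-approximation of w on the mesh Q_δ. Then ‖w − w^δ‖_{L^1(ℝ^n)} ≤ δ·K_δ(w) (an inequality in [0,∞]). -/
open MeasureTheory Filter Topology ENNReal

noncomputable section

/-- The standard open cube `(0, ε)^n` in `ℝ^n`. -/
def stdCube (n : ℕ) (ε : ℝ) : Set (EuclideanSpace ℝ (Fin n)) :=
  {x | ∀ i, x i ∈ Set.Ioo (0 : ℝ) ε}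

/-- `Q ⊆ ℝ^n` is an `ε`-cube: the image of `(0,ε)^n` under a rigid motion of `ℝ^n`. -/
def IsCube (n : ℕ) (ε : ℝ) (Q : Set (EuclideanSpace ℝ (Fin n))) : Prop :=
  ∃ T : EuclideanSpace ℝ (Fin n) ≃ᵢ EuclideanSpace ℝ (Fin n), Q = T '' stdCube n ε

/-- The BMO-type energy `K_ε(f)`: the supremum, over all countable families `H` of pairwise
disjoint `ε`-cubes, of `ε^(n-1) * Σ_{Q ∈ H} ⨍_Q |f - ⨍_Q f|`, valued in `[0,∞]`. -/
def K (n : ℕ) (ε : ℝ) (f : EuclideanSpace ℝ (Fin n) → ℝ) : ℝ≥0∞ :=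
  ⨆ (H : Set (Set (EuclideanSpace ℝ (Fin n)))) (_ : H.Countable)
    (_ : ∀ Q ∈ H, IsCube n ε Q) (_ : H.Pairwise Disjoint),
    ENNReal.ofReal (ε ^ (n - 1)) *
      ∑' Q : H, ENNReal.ofReal (⨍ x in (Q : Set (EuclideanSpace ℝ (Fin n))),
        |f x - ⨍ y in (Q : Set (EuclideanSpace ℝ (Fin n))), f y|)

/-- The divergence of a vector field `φ : ℝ^n → ℝ^n`. -/
def div' {n : ℕ} (φ : EuclideanSpace ℝ (Fin n) → EuclideanSpace ℝ (Fin n))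
    (x : EuclideanSpace ℝ (Fin n)) : ℝ :=
  ∑ i, fderiv ℝ φ x (EuclideanSpace.single i 1) i

/-- The extended total variation `|Df|(ℝ^n)`, valued in `[0,∞]`. -/
def totalVariation (n : ℕ) (f : EuclideanSpace ℝ (Fin n) → ℝ) : ℝ≥0∞ :=
  ⨆ (φ : EuclideanSpace ℝ (Fin n) → EuclideanSpace ℝ (Fin n)) (_ : ContDiff ℝ 1 φ)
    (_ : HasCompactSupport φ) (_ : ∀ x, ‖φ x‖ ≤ 1),
    ENNReal.ofReal (∫ x, f x * div' φ x)

/-- The mesh `Q_δ` of open `δ`-cubes with edges parallel to the coordinate axes: the cube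
indexed by `z ∈ ℤ^n` is `(0,δ)^n + δz`. -/
def meshCube (n : ℕ) (δ : ℝ) (z : Fin n → ℤ) : Set (EuclideanSpace ℝ (Fin n)) :=
  {x | ∀ i, x i ∈ Set.Ioo (δ * (z i : ℝ)) (δ * ((z i : ℝ) + 1))}

/-- The piecewise constant `δ`-approximation `w^δ` of `w` on the mesh `Q_δ`, equal on each
cube of the mesh to the average of `w` over that cube. -/
def pcn (n : ℕ) (δ : ℝ) (w : EuclideanSpace ℝ (Fin n) → ℝ)
    (x : EuclideanSpace ℝ (Fin n)) : ℝ :=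
  ⨍ y in meshCube n δ (fun i => ⌈x i / δ⌉ - 1), w y

/-- The cube `D_R = (-R, R)^n`. -/
def DCube (n : ℕ) (R : ℝ) : Set (EuclideanSpace ℝ (Fin n)) :=
  {x | ∀ i, x i ∈ Set.Ioo (-R) R}

theorem meshCube_eq_preimage (n : ℕ) (δ : ℝ) (z : Fin n → ℤ) :
    meshCube n δ z = (WithLp.ofLp : EuclideanSpace ℝ (Fin n) → Fin n → ℝ) ⁻¹'
      Set.pi Set.univ fun i => Set.Ioo (δ * (z i : ℝ)) (δ * ((z i : ℝ) + 1)) := by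
  ext x
  simp [meshCube]

theorem isCube_meshCube (n : ℕ) (δ : ℝ) (z : Fin n → ℤ) : IsCube n δ (meshCube n δ z) := by
  refine ⟨IsometryEquiv.addRight (WithLp.toLp 2 fun i => δ * (z i : ℝ)), ?_⟩
  ext x
  rw [← IsometryEquiv.coe_toEquiv, Equiv.image_eq_preimage_symm]
  refine forall_congr' fun i => ?_
  change _ ↔ x i + -(δ * (z i : ℝ)) ∈ Set.Ioo (0 : ℝ) δ
  simp only [Set.mem_Ioo]
  constructor <;> rintro ⟨h₁, h₂⟩ <;> constructor <;> linarith

theorem volume_meshCube (n : ℕ) {δ : ℝ} (hδ : 0 < δ) (z : Fin n → ℤ) :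
    volume (meshCube n δ z) = ENNReal.ofReal (δ ^ n) := by
  rw [meshCube_eq_preimage, (PiLp.volume_preserving_ofLp (Fin n)).measure_preimage
    (MeasurableSet.univ_pi fun i => measurableSet_Ioo).nullMeasurableSet, Real.volume_pi_Ioo]
  simp [mul_add, ENNReal.ofReal_pow hδ.le]

/-- The index of the half-open mesh cell `∏ (δ z_i, δ (z_i + 1)]` containing `x`. -/
def meshIndex (n : ℕ) (δ : ℝ) (x : EuclideanSpace ℝ (Fin n)) : Fin n → ℤ :=
  fun i => ⌈x i / δ⌉ - 1

theorem measurable_meshIndex (n : ℕ) (δ : ℝ) : Measurable (meshIndex n δ) := by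
  unfold meshIndex
  fun_prop

theorem meshIndex_preimage_singleton (n : ℕ) {δ : ℝ} (hδ : 0 < δ) (z : Fin n → ℤ) :
    meshIndex n δ ⁻¹' {z} = (WithLp.ofLp : EuclideanSpace ℝ (Fin n) → Fin n → ℝ) ⁻¹'
      Set.pi Set.univ fun i => Set.Ioc (δ * (z i : ℝ)) (δ * ((z i : ℝ) + 1)) := by
  ext x
  simp only [Set.mem_preimage, Set.mem_singleton_iff, funext_iff, meshIndex, Set.mem_univ_pi,
    sub_eq_iff_eq_add, Int.ceil_eq_iff, lt_div_iff₀ hδ, div_le_iff₀ hδ, Set.mem_Ioc]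
  refine forall_congr' fun i => ?_
  push_cast
  rw [add_sub_cancel_right, mul_comm, mul_comm _ δ]

theorem meshIndex_preimage_singleton_ae_eq (n : ℕ) {δ : ℝ} (hδ : 0 < δ) (z : Fin n → ℤ) :
    meshIndex n δ ⁻¹' {z} =ᵐ[volume] meshCube n δ z := by
  rw [meshIndex_preimage_singleton n hδ, meshCube_eq_preimage]
  exact (PiLp.volume_preserving_ofLp (Fin n)).quasiMeasurePreserving.preimage_ae_eq
    (Measure.univ_pi_Ioc_ae_eq_Icc.trans Measure.univ_pi_Ioo_ae_eq_Icc.symm)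

theorem meshCube_subset_preimage (n : ℕ) {δ : ℝ} (hδ : 0 < δ) (z : Fin n → ℤ) :
    meshCube n δ z ⊆ meshIndex n δ ⁻¹' {z} := by
  rw [meshIndex_preimage_singleton n hδ, meshCube_eq_preimage]
  exact Set.preimage_mono (Set.pi_mono fun i _ => Set.Ioo_subset_Ioc_self)

theorem pairwise_disjoint_meshCube (n : ℕ) {δ : ℝ} (hδ : 0 < δ) :
    Pairwise (Function.onFun Disjoint (meshCube n δ)) := fun _ _ h =>
  ((Set.disjoint_singleton.2 h).preimage _).mono (meshCube_subset_preimage n hδ _)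
    (meshCube_subset_preimage n hδ _)

theorem nonempty_meshCube (n : ℕ) {δ : ℝ} (hδ : 0 < δ) (z : Fin n → ℤ) :
    (meshCube n δ z).Nonempty := by
  apply nonempty_of_measure_ne_zero (μ := volume)
  rw [volume_meshCube n hδ]
  exact (ENNReal.ofReal_pos.2 (pow_pos hδ n)).ne'

theorem meshCube_injective (n : ℕ) {δ : ℝ} (hδ : 0 < δ) :
    Function.Injective (meshCube n δ) := fun a b h => by
  obtain ⟨x, hx⟩ := nonempty_meshCube n hδ a
  have ha : meshIndex n δ x = a := meshCube_subset_preimage n hδ a hx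
  have hb : meshIndex n δ x = b := meshCube_subset_preimage n hδ b (h ▸ hx)
  exact ha.symm.trans hb

theorem isBounded_meshCube (n : ℕ) (δ : ℝ) (z : Fin n → ℤ) :
    Bornology.IsBounded (meshCube n δ z) := by
  rw [meshCube_eq_preimage]
  exact (PiLp.antilipschitzWith_ofLp 2 fun _ : Fin n => ℝ).isBounded_preimage
    (Bornology.IsBounded.pi fun i => Metric.isBounded_Ioo _ _)

theorem setLIntegral_meshCube_oscillation (n : ℕ) {δ : ℝ} (hδ : 0 < δ) (z : Fin n → ℤ)
    {w : EuclideanSpace ℝ (Fin n) → ℝ} (hw : LocallyIntegrable w volume) (c : ℝ) :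
    ∫⁻ x in meshCube n δ z, ENNReal.ofReal |w x - c| =
      ENNReal.ofReal (δ ^ n) * ENNReal.ofReal (⨍ x in meshCube n δ z, |w x - c|) := by
  have hfin : volume (meshCube n δ z) ≠ ∞ := by
    rw [volume_meshCube n hδ]
    exact ENNReal.ofReal_ne_top
  have hint : IntegrableOn w (meshCube n δ z) :=
    (hw.integrableOn_isCompact (isBounded_meshCube n δ z).isCompact_closure).mono_set
      subset_closure
  have hosc : IntegrableOn (fun x => |w x - c|) (meshCube n δ z) :=
    (hint.sub (integrableOn_const hfin)).abs
  rw [← ofReal_integral_eq_lintegral_ofReal hosc (ae_of_all _ fun x => abs_nonneg _),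
    ← ENNReal.ofReal_mul (pow_nonneg hδ.le n), setAverage_eq, measureReal_def,
    volume_meshCube n hδ, ENNReal.toReal_ofReal (pow_nonneg hδ.le n), smul_eq_mul,
    mul_inv_cancel_left₀ (pow_pos hδ n).ne']

/-- `‖w - w^δ‖_{L^1(ℝ^n)} ≤ δ·K_δ(w)`, as an inequality in `[0,∞]`. -/
theorem stmt12 (n : ℕ) (hn : 1 ≤ n) (w : EuclideanSpace ℝ (Fin n) → ℝ)
    (hw : LocallyIntegrable w volume) (δ : ℝ) (hδ : 0 < δ) :
    ∫⁻ x, ENNReal.ofReal |w x - pcn n δ w x| ≤ ENNReal.ofReal δ * K n δ w := by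
  have hsplit : ∫⁻ x, ENNReal.ofReal |w x - pcn n δ w x| =
      ENNReal.ofReal (δ ^ n) * ∑' z, ENNReal.ofReal
        (⨍ x in meshCube n δ z, |w x - ⨍ y in meshCube n δ z, w y|) := by
    have hmeas (z : Fin n → ℤ) : MeasurableSet (meshIndex n δ ⁻¹' {z}) :=
      measurable_meshIndex n δ (measurableSet_singleton z)
    have hdisj : Pairwise (Function.onFun Disjoint fun z => meshIndex n δ ⁻¹' {z}) :=
      fun _ _ h => (Set.disjoint_singleton.2 h).preimage _
    have hcover : ⋃ z, meshIndex n δ ⁻¹' {z} = Set.univ := by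
      rw [← Set.preimage_iUnion, Set.iUnion_of_singleton, Set.preimage_univ]
    rw [← setLIntegral_univ, ← hcover, lintegral_iUnion hmeas hdisj, ← ENNReal.tsum_mul_left]
    refine tsum_congr fun z => ?_
    rw [← setLIntegral_meshCube_oscillation n hδ z hw,
      ← setLIntegral_congr (meshIndex_preimage_singleton_ae_eq n hδ z)]
    refine setLIntegral_congr_fun (hmeas z) fun x hx => ?_
    have hx' : (fun i => ⌈x i / δ⌉ - 1) = z := hx
    simp only [pcn, hx']
  have hK : ENNReal.ofReal (δ ^ (n - 1)) * ∑' z, ENNReal.ofReal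
      (⨍ x in meshCube n δ z, |w x - ⨍ y in meshCube n δ z, w y|) ≤ K n δ w := by
    refine le_trans (le_of_eq ?_) (le_iSup₂_of_le (Set.range (meshCube n δ))
      (Set.countable_range _) (le_iSup₂_of_le (Set.forall_mem_range.2 (isCube_meshCube n δ))
        (pairwise_disjoint_meshCube n hδ).range_pairwise le_rfl))
    rw [tsum_range (fun Q : Set (EuclideanSpace ℝ (Fin n)) =>
      ENNReal.ofReal (⨍ x in Q, |w x - ⨍ y in Q, w y|)) (meshCube_injective n hδ)]
  calc
    _ = ENNReal.ofReal δ * (ENNReal.ofReal (δ ^ (n - 1)) * ∑' z, ENNReal.ofReal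
        (⨍ x in meshCube n δ z, |w x - ⨍ y in meshCube n δ z, w y|)) := by
      rw [hsplit, ← mul_assoc, ← ENNReal.ofReal_mul hδ.le, mul_pow_sub_one (by omega)]
    _ ≤ _ := by gcongr
end
end

section
/- Let n ≥ 1, w ∈ L^1_loc(ℝ^n) and δ > 0, and let Q ∈ Q_δ be a cube of the mesh Q_δ. Then ‖w − w^{δ/2}‖_{L^1(Q)} ≤ (1 + 2^n)·‖w − w^δ‖_{L^1(Q)}, where w^δ and w^{δ/2} are the piecewise constant approximations of w on the meshes Q_δ and Q_{δ/2} respectively. -/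
open MeasureTheory Filter Topology ENNReal

noncomputable section

/-- The half-open cell of the mesh `Q_δ` indexed by `z`, on which `pcn n δ w` is constant. -/
def meshCell (n : ℕ) (δ : ℝ) (z : Fin n → ℤ) : Set (EuclideanSpace ℝ (Fin n)) :=
  {x | (fun i => ⌈x i / δ⌉ - 1) = z}

theorem mem_meshCell_iff {n : ℕ} {δ : ℝ} (hδ : 0 < δ) {z : Fin n → ℤ}
    {x : EuclideanSpace ℝ (Fin n)} :
    x ∈ meshCell n δ z ↔ ∀ i, x i ∈ Set.Ioc (δ * (z i : ℝ)) (δ * ((z i : ℝ) + 1)) := by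
  simp only [meshCell, Set.mem_ofPred_eq, funext_iff, sub_eq_iff_eq_add, Int.ceil_eq_iff,
    lt_div_iff₀ hδ, div_le_iff₀ hδ, Set.mem_Ioc]
  push_cast
  simp only [add_sub_cancel_right, mul_comm δ]

theorem measurableSet_meshCell (n : ℕ) (δ : ℝ) (z : Fin n → ℤ) :
    MeasurableSet (meshCell n δ z) := by
  have hm : Measurable fun x : EuclideanSpace ℝ (Fin n) => fun i => ⌈x i / δ⌉ - 1 := by
    fun_prop
  exact hm (measurableSet_singleton z)

theorem disjoint_meshCell {n : ℕ} {δ : ℝ} {z z' : Fin n → ℤ} (h : z ≠ z') :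
    Disjoint (meshCell n δ z) (meshCell n δ z') :=
  Set.disjoint_left.2 fun _ hx hx' => h (Eq.trans (Eq.symm hx) hx')

theorem meshCube_ae_eq_meshCell {n : ℕ} {δ : ℝ} (hδ : 0 < δ) (z : Fin n → ℤ) :
    meshCube n δ z =ᵐ[volume] meshCell n δ z := by
  have h := (PiLp.volume_preserving_ofLp (Fin n)).quasiMeasurePreserving.preimage_ae_eq
    (Measure.pi_Ioo_ae_eq_pi_Ioc (μ := fun _ => volume) (s := Set.univ)
      (f := fun i => δ * (z i : ℝ)) (g := fun i => δ * ((z i : ℝ) + 1)))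
  have hcube : meshCube n δ z = WithLp.ofLp ⁻¹'
      Set.univ.pi fun i => Set.Ioo (δ * (z i : ℝ)) (δ * ((z i : ℝ) + 1)) := by
    ext x
    simp [meshCube]
  have hcell : meshCell n δ z = WithLp.ofLp ⁻¹'
      Set.univ.pi fun i => Set.Ioc (δ * (z i : ℝ)) (δ * ((z i : ℝ) + 1)) := by
    ext x
    simp [mem_meshCell_iff hδ]
  rwa [hcube, hcell]

theorem pcn_eq_setAverage {n : ℕ} {δ : ℝ} (hδ : 0 < δ) (w : EuclideanSpace ℝ (Fin n) → ℝ)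
    {z : Fin n → ℤ} {x : EuclideanSpace ℝ (Fin n)} (hx : x ∈ meshCell n δ z) :
    pcn n δ w x = ⨍ y in meshCell n δ z, w y := by
  have hz : (fun i => ⌈x i / δ⌉ - 1) = z := hx
  rw [pcn, hz, setAverage_congr (meshCube_ae_eq_meshCell hδ z)]

theorem isBounded_meshCell {n : ℕ} {δ : ℝ} (hδ : 0 < δ) (z : Fin n → ℤ) :
    Bornology.IsBounded (meshCell n δ z) := by
  refine ((PiLp.antilipschitzWith_ofLp 2 (fun _ : Fin n => ℝ)).isBounded_preimage
    (Metric.isBounded_Icc (fun i => δ * (z i : ℝ)) fun i => δ * ((z i : ℝ) + 1))).subset ?_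
  intro x hx
  rw [mem_meshCell_iff hδ] at hx
  exact ⟨fun i => (hx i).1.le, fun i => (hx i).2⟩

/-- Each cell of the mesh `Q_δ` is the disjoint union of `2 ^ n` cells of `Q_{δ/2}`. -/
theorem meshCell_eq_biUnion {n : ℕ} {δ : ℝ} (hδ : 0 < δ) (z : Fin n → ℤ) :
    meshCell n δ z =
      ⋃ z' ∈ Fintype.piFinset fun i => ({2 * z i, 2 * z i + 1} : Finset ℤ),
        meshCell n (δ / 2) z' := by
  ext x
  simp only [Set.mem_iUnion, exists_prop, Fintype.mem_piFinset, Finset.mem_insert,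
    Finset.mem_singleton]
  constructor
  · intro hx
    rw [mem_meshCell_iff hδ] at hx
    refine ⟨fun i => ⌈x i / (δ / 2)⌉ - 1, fun i => ?_, rfl⟩
    obtain ⟨h₁, h₂⟩ := hx i
    have hlow : 2 * z i < ⌈x i / (δ / 2)⌉ := by
      rw [Int.lt_ceil, lt_div_iff₀ (half_pos hδ)]
      push_cast
      linarith
    have hupp : ⌈x i / (δ / 2)⌉ ≤ 2 * z i + 2 := by
      rw [Int.ceil_le, div_le_iff₀ (half_pos hδ)]
      push_cast
      linarith
    beta_reduce
    omega
  · rintro ⟨z', hz', hx⟩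
    rw [mem_meshCell_iff (half_pos hδ)] at hx
    rw [mem_meshCell_iff hδ]
    intro i
    obtain ⟨h₁, h₂⟩ := hx i
    rcases hz' i with h | h <;> rw [h] at h₁ h₂ <;> push_cast at h₁ h₂ <;>
      constructor <;> linarith

/-- The mean is a near-minimizer of the `L¹` distance to constants. -/
theorem integral_abs_sub_average_le {α : Type*} [MeasurableSpace α] {μ : Measure α}
    [IsFiniteMeasure μ] {f : α → ℝ} (hf : Integrable f μ) (c : ℝ) :
    ∫ x, |f x - ⨍ y, f y ∂μ| ∂μ ≤ 2 * ∫ x, |f x - c| ∂μ := by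
  have hfc : Integrable (fun x => |f x - c|) μ := (hf.sub (integrable_const c)).abs
  have hmean : μ.real Set.univ * |c - ⨍ y, f y ∂μ| ≤ ∫ x, |f x - c| ∂μ := by
    have havg : μ.real Set.univ * (c - ⨍ y, f y ∂μ) = -∫ x, (f x - c) ∂μ := by
      rw [mul_sub, ← smul_eq_mul _ (⨍ y, f y ∂μ), measure_smul_average,
        integral_sub hf (integrable_const c), integral_const, smul_eq_mul]
      ring
    rw [← abs_of_nonneg (measureReal_nonneg (μ := μ) (s := Set.univ)), ← abs_mul, havg, abs_neg]
    exact abs_integral_le_integral_abs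
  calc ∫ x, |f x - ⨍ y, f y ∂μ| ∂μ
      ≤ ∫ x, (|f x - c| + |c - ⨍ y, f y ∂μ|) ∂μ :=
        integral_mono (hf.sub (integrable_const _)).abs (hfc.add (integrable_const _))
          fun x => abs_sub_le _ _ _
    _ = ∫ x, |f x - c| ∂μ + μ.real Set.univ * |c - ⨍ y, f y ∂μ| := by
        rw [integral_add hfc (integrable_const _), integral_const, smul_eq_mul]
    _ ≤ 2 * ∫ x, |f x - c| ∂μ := by linarith

/-- For every cube `Q` of the mesh `Q_δ`,
`‖w - w^{δ/2}‖_{L^1(Q)} ≤ (1 + 2^n)·‖w - w^δ‖_{L^1(Q)}`. -/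
theorem stmt14 (n : ℕ) (hn : 1 ≤ n) (w : EuclideanSpace ℝ (Fin n) → ℝ)
    (hw : LocallyIntegrable w volume) (δ : ℝ) (hδ : 0 < δ) (z : Fin n → ℤ) :
    ∫ x in meshCube n δ z, |w x - pcn n (δ / 2) w x| ≤
      (1 + 2 ^ n) * ∫ x in meshCube n δ z, |w x - pcn n δ w x| := by
  have hδ' : 0 < δ / 2 := half_pos hδ
  set c : ℝ := ⨍ y in meshCell n δ z, w y
  set t := Fintype.piFinset fun i => ({2 * z i, 2 * z i + 1} : Finset ℤ)
  have hfin (z' : Fin n → ℤ) :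
      IsFiniteMeasure ((volume : Measure (EuclideanSpace ℝ (Fin n))).restrict
        (meshCell n (δ / 2) z')) :=
    isFiniteMeasure_restrict.2 (isBounded_meshCell hδ' z').measure_lt_top.ne
  have hint (z' : Fin n → ℤ) : IntegrableOn w (meshCell n (δ / 2) z') :=
    (hw.integrableOn_isCompact (isBounded_meshCell hδ' z').isCompact_closure).mono_set
      subset_closure
  have hcoarse : ∫ x in meshCube n δ z, |w x - pcn n δ w x| =
      ∑ z' ∈ t, ∫ x in meshCell n (δ / 2) z', |w x - c| := by
    rw [setIntegral_congr_set (meshCube_ae_eq_meshCell hδ z),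
      setIntegral_congr_fun (g := fun x => |w x - c|) (measurableSet_meshCell n δ z)
        fun x hx => by simp only [pcn_eq_setAverage hδ w hx, c],
      meshCell_eq_biUnion hδ z]
    exact integral_biUnion_finset t (fun z' _ => measurableSet_meshCell n _ z')
      (fun _ _ _ _ h => disjoint_meshCell h)
      fun z' _ => ((hint z').sub (integrable_const c)).abs
  have hcell (z' : Fin n → ℤ) : Set.EqOn (fun x => |w x - pcn n (δ / 2) w x|)
      (fun x => |w x - ⨍ y in meshCell n (δ / 2) z', w y|) (meshCell n (δ / 2) z') :=
    fun x hx => by simp only [pcn_eq_setAverage hδ' w hx]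
  have hfine : ∫ x in meshCube n δ z, |w x - pcn n (δ / 2) w x| =
      ∑ z' ∈ t, ∫ x in meshCell n (δ / 2) z', |w x - ⨍ y in meshCell n (δ / 2) z', w y| := by
    rw [setIntegral_congr_set (meshCube_ae_eq_meshCell hδ z), meshCell_eq_biUnion hδ z,
      integral_biUnion_finset t (fun z' _ => measurableSet_meshCell n _ z')
        (fun _ _ _ _ h => disjoint_meshCell h)
        fun z' _ => IntegrableOn.congr_fun ((hint z').sub (integrable_const _)).abs
          (hcell z').symm (measurableSet_meshCell n _ z')]
    exact Finset.sum_congr rfl fun z' _ =>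
      setIntegral_congr_fun (measurableSet_meshCell n _ z') (hcell z')
  calc ∫ x in meshCube n δ z, |w x - pcn n (δ / 2) w x|
      ≤ 2 * ∫ x in meshCube n δ z, |w x - pcn n δ w x| := by
        rw [hfine, hcoarse, Finset.mul_sum]
        exact Finset.sum_le_sum fun z' _ => integral_abs_sub_average_le (hint z') c
    _ ≤ (1 + 2 ^ n) * ∫ x in meshCube n δ z, |w x - pcn n δ w x| := by
        gcongr
        linarith [one_le_pow₀ (one_le_two : (1 : ℝ) ≤ 2) (n := n)]
end
end
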